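/- arXiv:1401.4650 — 3 statements merged into one kernel-verified Lean document; each statement's English description precedes it below -/
import Mathlib

section
/- For every q ≥ 2, k ≥ 2 and n ≥ 2, any two consecutive words of the list H_{n,q}^{(k)} have Hamming distance exactly 1, i.e., they differ in exactly one position. -/
/-- Hamming distance between two words (of the same length): number of differing positions. -/
def hamming (a b : List ℕ) : ℕ :=
  ((a.zip b).filter (fun p => p.1 ≠ p.2)).length

/-- The generalized reflected Gray code list `G_{n,q}` over the alphabet `{1,…,q-1}`. -/
def G (q : ℕ) : ℕ → List (List ℕ)
  | 0 => [[]]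
  | n + 1 =>
    (List.range (q - 1)).flatMap (fun j =>
      (if (j + 1) % 2 = 1 then G q n else (G q n).reverse).map (fun w => (j + 1) :: w))

/-- Replace the 1's of a binary word (first arg), read from left to right,
by the letters of the second word. -/
def subst : List ℕ → List ℕ → List ℕ
  | [], _ => []
  | 0 :: β, w => 0 :: subst β w
  | _ :: β, w => w.headD 0 :: subst β w.tail

/-- The expansion `ε(β)` of a binary word `β` w.r.t. the alphabet `{0,…,q-1}`. -/
def expand (q : ℕ) (β : List ℕ) : List (List ℕ) :=
  (G q (β.count 1)).map (fun w => subst β w)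

/-- The trace of a word: replace every nonzero letter by 1. -/
def trace (w : List ℕ) : List ℕ := w.map (fun x => if x = 0 then 0 else 1)

/-- The modified binary reflected Gray code list `C_n`. -/
def C : ℕ → List (List ℕ)
  | 0 => [[]]
  | n + 1 => (C n).reverse.map (fun w => 1 :: w) ++ (C n).map (fun w => 0 :: w)

/-- The Gray code list `F_n^{(k)}` of length-`n` binary words avoiding `k` consecutive 0's. -/
def F (k n : ℕ) : List (List ℕ) :=
  if h : n < k then C n
  else (List.range k).attach.flatMap (fun ℓ =>
    ((F k (n - 1 - ℓ.1)).reverse).map (fun w => List.replicate ℓ.1 0 ++ 1 :: w))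
termination_by n
decreasing_by
  have := List.mem_range.mp ℓ.2
  omega

/-- The list `H_{n,q}^{(k)}`. -/
def H (q k n : ℕ) : List (List ℕ) :=
  ((F k (n - 2)).zipIdx).flatMap (fun p =>
    if p.2 % 2 = 0 then expand q (1 :: (p.1 ++ [1]))
    else (expand q (1 :: (p.1 ++ [1]))).reverse)

/-- The list `S_{n,q}^{(k)}`. -/
def S (q k n : ℕ) : List (List ℕ) :=
  (H q k (n - k)).map (fun w => List.replicate k 0 ++ w)

/-- The `k`-Fibonacci numbers. -/
def kfib (k n : ℕ) : ℕ :=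
  if n < k then 2 ^ n
  else ∑ i ∈ (Finset.range k).attach, kfib k (n - 1 - i.1)
termination_by n
decreasing_by
  have := Finset.mem_range.mp i.2
  omega

/-- The list `F_n^{(k)}(u)` (second recursive definition). -/
def Faux (k : ℕ) : ℕ → ℕ → List (List ℕ)
  | 0, _ => [[]]
  | n + 1, 0 => (Faux k n (k - 1)).reverse.map (fun w => 1 :: w)
  | n + 1, u + 1 =>
    (Faux k n (k - 1)).reverse.map (fun w => 1 :: w) ++ (Faux k n u).map (fun w => 0 :: w)



/-- Two words differ in exactly one position (and have the same length). -/
inductive DiffOne : List ℕ → List ℕ → Prop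
  | head (x y : ℕ) (a : List ℕ) (h : x ≠ y) : DiffOne (x :: a) (y :: a)
  | tail (x : ℕ) (a b : List ℕ) (h : DiffOne a b) : DiffOne (x :: a) (x :: b)

theorem DiffOne.symm {a b : List ℕ} (h : DiffOne a b) : DiffOne b a := by
  induction h with
  | head x y a h => exact .head _ _ _ h.symm
  | tail x a b h ih => exact .tail _ _ _ ih

theorem hamming_self (a : List ℕ) : hamming a a = 0 := by
  induction a with
  | nil => rfl
  | cons x a ih => simpa [hamming] using ih

theorem DiffOne.hamming {a b : List ℕ} (h : DiffOne a b) : hamming a b = 1 := by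
  induction h with
  | head x y a h =>
    have := hamming_self a
    simp only [_root_.hamming] at *
    simp [h] at *
    exact this
  | tail x a b h ih => simpa [_root_.hamming] using ih

theorem DiffOne.append_right {a b : List ℕ} (h : DiffOne a b) (c : List ℕ) :
    DiffOne (a ++ c) (b ++ c) := by
  induction h with
  | head x y a h => exact .head _ _ _ h
  | tail x a b h ih => exact .tail _ _ _ ih

theorem DiffOne.append_left {a b : List ℕ} (h : DiffOne a b) (c : List ℕ) :
    DiffOne (c ++ a) (c ++ b) := by
  induction c with
  | nil => exact h
  | cons x c ih => exact .tail _ _ _ ih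

theorem DiffOne.map {a b : List ℕ} (h : DiffOne a b) (f : ℕ → ℕ)
    (ha : ∀ x ∈ a, x < 2) (hb : ∀ x ∈ b, x < 2) (hf : f 0 ≠ f 1) :
    DiffOne (a.map f) (b.map f) := by
  induction h with
  | head x y a h =>
    refine .head _ _ _ ?_
    have h1 : x < 2 := ha x (by simp)
    have h2 : y < 2 := hb y (by simp)
    interval_cases x <;> interval_cases y <;> simp_all
    exact fun h => hf h.symm
  | tail x a b h ih =>
    exact .tail _ _ _ (ih (fun x hx => ha x (by simp [hx])) (fun x hx => hb x (by simp [hx])))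

theorem chain_reverse {l : List (List ℕ)} (h : l.IsChain DiffOne) :
    l.reverse.IsChain DiffOne := by
  rw [List.isChain_reverse]
  exact h.imp (fun _ _ h => h.symm)

theorem chain_map {l : List (List ℕ)} (h : l.IsChain DiffOne) (f : List ℕ → List ℕ)
    (hf : ∀ a ∈ l, ∀ b ∈ l, DiffOne a b → DiffOne (f a) (f b)) :
    (l.map f).IsChain DiffOne := by
  rw [List.isChain_iff_getElem] at h ⊢
  intro i hi
  simp only [List.length_map] at hi
  simp only [List.getElem_map]
  exact hf _ (List.getElem_mem _) _ (List.getElem_mem _) (h i hi)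

theorem chain_flatMap {α : Type} (L : List α) (f : α → List (List ℕ))
    (hne : ∀ x ∈ L, f x ≠ [])
    (h1 : ∀ x ∈ L, (f x).IsChain DiffOne)
    (h2 : ∀ i, ∀ h : i + 1 < L.length, ∀ x ∈ (f L[i]).getLast?, ∀ y ∈ (f L[i+1]).head?,
      DiffOne x y) :
    (L.flatMap f).IsChain DiffOne := by
  rw [List.flatMap_def, List.isChain_flatten]
  · refine ⟨by simpa using h1, ?_⟩
    rw [List.isChain_iff_getElem]
    intro i hi
    simp only [List.length_map] at hi
    simp only [List.getElem_map]
    exact h2 i hi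
  · simpa using hne

/-! The lists `G`. -/

theorem G_ne (q : ℕ) (hq : 2 ≤ q) (t : ℕ) : G q t ≠ [] := by
  induction t with
  | zero => simp [G]
  | succ t ih =>
    simp only [G, ne_eq, List.flatMap_eq_nil_iff, not_forall]
    refine ⟨0, by simp; omega, by simpa using ih⟩

theorem G_length (q t : ℕ) : ∀ w ∈ G q t, w.length = t := by
  induction t with
  | zero => simp [G]
  | succ t ih =>
    intro w hw
    simp only [G, List.mem_flatMap, List.mem_map] at hw
    obtain ⟨j, -, v, hv, rfl⟩ := hw
    have : v ∈ G q t := by split at hv <;> simpa using hv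
    simp [ih v this]

theorem G_chain (q : ℕ) (hq : 2 ≤ q) (t : ℕ) : (G q t).IsChain DiffOne := by
  induction t with
  | zero => simp [G]
  | succ t ih =>
    rw [G]
    apply chain_flatMap
    · intro j _
      have := G_ne q hq t
      split <;> simpa using this
    · intro j _
      apply chain_map
      · split
        · exact ih
        · exact chain_reverse ih
      · intro a _ b _ h
        exact .tail _ _ _ h
    · intro i hi x hx y hy
      simp only [List.getElem_range, List.getLast?_map, List.head?_map] at hx hy
      rcases Nat.mod_two_eq_zero_or_one (i + 1) with h | h
      · have h' : (i + 1 + 1) % 2 = 1 := by omega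
        simp only [h, h', if_true, Nat.zero_ne_one, if_false, List.getLast?_reverse] at hx hy
        cases hg : (G q t).head? with
        | none => simp [hg] at hx
        | some g =>
          simp [hg] at hx hy
          subst hx hy
          exact .head _ _ _ (by omega)
      · have h' : (i + 1 + 1) % 2 = 0 := by omega
        simp only [h, h', if_true, Nat.zero_ne_one, if_false, List.head?_reverse] at hx hy
        cases hg : (G q t).getLast? with
        | none => simp [hg] at hx
        | some g =>
          simp [hg] at hx hy
          subst hx hy
          exact .head _ _ _ (by omega)

theorem G_head (q : ℕ) (hq : 2 ≤ q) (t : ℕ) : (G q t).head? = some (List.replicate t 1) := by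
  induction t with
  | zero => simp [G]
  | succ t ih =>
    obtain ⟨r, rfl⟩ : ∃ r, q = r + 2 := ⟨q - 2, by omega⟩
    simp [G, List.range_succ_eq_map, List.head?_append, ih, List.replicate_succ]

/-- The letter following the first one in the last word of `G`. -/
def lastLetter (q : ℕ) : ℕ := if q % 2 = 0 then q - 1 else 1

theorem G_last (q : ℕ) (hq : 2 ≤ q) (t : ℕ) :
    (G q (t + 1)).getLast? = some ((q - 1) :: List.replicate t (lastLetter q)) := by
  induction t with
  | zero =>
    obtain ⟨r, rfl⟩ : ∃ r, q = r + 2 := ⟨q - 2, by omega⟩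
    simp [G, List.range_succ, List.getLast?_append]
  | succ t ih =>
    have hh := G_head q hq (t + 1)
    obtain ⟨r, rfl⟩ : ∃ r, q = r + 2 := ⟨q - 2, by omega⟩
    rw [G]
    have e : r + 2 - 1 = r + 1 := by omega
    rw [e] at ih ⊢
    rw [List.range_succ, List.flatMap_append, List.getLast?_append]
    rcases Nat.mod_two_eq_zero_or_one r with h | h
    · have h' : (r + 1) % 2 = 1 := by omega
      simp [h', ih, lastLetter, h, List.replicate_succ]
    · have h' : (r + 1) % 2 = 0 := by omega
      simp [h', hh, lastLetter, h, List.replicate_succ]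

/-! Substitution. -/

theorem subst_diff (β : List ℕ) (hβ : ∀ x ∈ β, x < 2) : ∀ w w' : List ℕ,
    w.length = β.count 1 → DiffOne w w' → DiffOne (subst β w) (subst β w') := by
  induction β with
  | nil =>
    intro w w' hl h
    cases h <;> simp at hl
  | cons x β ih =>
    have ih := ih (fun x hx => hβ x (by simp [hx]))
    have hx : x < 2 := hβ x (by simp)
    intro w w' hl h
    interval_cases x
    · simp only [subst]
      exact .tail _ _ _ (ih w w' (by simpa using hl) h)
    · cases h with
      | head x y a h => simpa [subst] using DiffOne.head _ _ _ h
      | tail x a b h =>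
        simpa [subst] using DiffOne.tail _ _ _ (ih a b (by simpa using hl) h)

theorem subst_replicate (β : List ℕ) (hβ : ∀ x ∈ β, x < 2) (c : ℕ) :
    subst β (List.replicate (β.count 1) c) = β.map (fun x => if x = 0 then 0 else c) := by
  induction β with
  | nil => rfl
  | cons x β ih =>
    have ih := ih (fun x hx => hβ x (by simp [hx]))
    have hx : x < 2 := hβ x (by simp)
    interval_cases x
    · simpa [subst] using ih
    · simpa [subst, List.replicate_succ] using ih

theorem expand_chain (q : ℕ) (hq : 2 ≤ q) (β : List ℕ) (hβ : ∀ x ∈ β, x < 2) :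
    (expand q β).IsChain DiffOne := by
  apply chain_map (G_chain q hq _)
  intro a ha b _ h
  exact subst_diff β hβ a b (G_length _ _ a ha) h

theorem expand_head (q : ℕ) (hq : 2 ≤ q) (β : List ℕ) (hβ : ∀ x ∈ β, x < 2) :
    (expand q (1 :: β)).head? = some (1 :: β.map (fun x => if x = 0 then 0 else 1)) := by
  simp [expand, G_head q hq, List.replicate_succ, subst, subst_replicate β hβ]

theorem expand_last (q : ℕ) (hq : 2 ≤ q) (β : List ℕ) (hβ : ∀ x ∈ β, x < 2) :
    (expand q (1 :: β)).getLast? =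
      some ((q - 1) :: β.map (fun x => if x = 0 then 0 else lastLetter q)) := by
  simp [expand, G_last q hq, subst, subst_replicate β hβ]

/-! The lists `C` and `F`. -/

theorem C_ne (n : ℕ) : C n ≠ [] := by
  induction n with
  | zero => simp [C]
  | succ n ih => simp [C, ih]

theorem C_bin (n : ℕ) : ∀ w ∈ C n, ∀ x ∈ w, x < 2 := by
  induction n with
  | zero => simp [C]
  | succ n ih =>
    intro w hw x hx
    simp only [C, List.mem_append, List.mem_map, List.mem_reverse] at hw
    rcases hw with ⟨v, hv, rfl⟩ | ⟨v, hv, rfl⟩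
    all_goals
      rcases List.mem_cons.1 hx with rfl | hx
      · omega
      · exact ih v hv x hx

theorem C_chain (n : ℕ) : (C n).IsChain DiffOne := by
  induction n with
  | zero => simp [C]
  | succ n ih =>
    rw [C, List.isChain_append]
    refine ⟨chain_map (chain_reverse ih) _ fun _ _ _ _ h => .tail _ _ _ h,
      chain_map ih _ fun _ _ _ _ h => .tail _ _ _ h, ?_⟩
    intro x hx y hy
    simp only [List.getLast?_map, List.head?_map, List.getLast?_reverse] at hx hy
    cases hg : (C n).head? with
    | none => simp [hg] at hx
    | some g =>
      simp [hg] at hx hy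
      subst hx hy
      exact .head _ _ _ (by omega)

theorem F_small (k n : ℕ) (h : n < k) : F k n = C n := by
  rw [F, dif_pos h]

theorem F_big (k n : ℕ) (h : k ≤ n) : F k n = (List.range k).flatMap (fun l =>
    ((F k (n - 1 - l)).reverse).map (fun w => List.replicate l 0 ++ 1 :: w)) := by
  rw [F, dif_neg (by omega)]
  simp [List.flatMap_subtype]

theorem F_ne (k : ℕ) (hk : 2 ≤ k) (n : ℕ) : F k n ≠ [] := by
  induction n using Nat.strong_induction_on with
  | _ n ih =>
    rcases lt_or_ge n k with h | h
    · rw [F_small k n h]; exact C_ne n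
    · rw [F_big k n h]
      simp only [ne_eq, List.flatMap_eq_nil_iff, not_forall]
      exact ⟨0, by simp; omega, by simpa using ih (n - 1) (by omega)⟩

theorem F_bin (k n : ℕ) : ∀ w ∈ F k n, ∀ x ∈ w, x < 2 := by
  induction n using Nat.strong_induction_on with
  | _ n ih =>
    rcases lt_or_ge n k with h | h
    · rw [F_small k n h]; exact C_bin n
    · rw [F_big k n h]
      intro w hw x hx
      simp only [List.mem_flatMap, List.mem_map, List.mem_reverse, List.mem_range] at hw
      obtain ⟨l, hl, v, hv, rfl⟩ := hw
      simp only [List.mem_append, List.mem_replicate, List.mem_cons] at hx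
      rcases hx with hx | hx | hx
      · omega
      · omega
      · exact ih _ (by omega) v hv x hx

theorem F_head (k : ℕ) (hk : 2 ≤ k) (m : ℕ) :
    (F k (m + 1)).head? = (F k m).getLast?.map (fun w => 1 :: w) := by
  rcases lt_or_ge (m + 1) k with h | h
  · rw [F_small k _ h, F_small k m (by omega), C]
    cases hg : (C m).getLast? with
    | none => exact absurd (List.getLast?_eq_none_iff.1 hg) (C_ne m)
    | some g => simp [List.head?_append, hg]
  · rw [F_big k _ h]
    obtain ⟨r, rfl⟩ : ∃ r, k = r + 1 := ⟨k - 1, by omega⟩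
    cases hg : (F (r + 1) m).getLast? with
    | none => exact absurd (List.getLast?_eq_none_iff.1 hg) (F_ne _ hk m)
    | some g => simp [List.range_succ_eq_map, List.head?_append, hg]

theorem F_chain (k : ℕ) (hk : 2 ≤ k) (n : ℕ) : (F k n).IsChain DiffOne := by
  induction n using Nat.strong_induction_on with
  | _ n ih =>
    rcases lt_or_ge n k with h | h
    · rw [F_small k n h]; exact C_chain n
    · rw [F_big k n h]
      apply chain_flatMap
      · intro l _
        simpa using F_ne k hk _
      · intro l _
        exact chain_map (chain_reverse (ih _ (by omega))) _
          fun _ _ _ _ h => (DiffOne.tail _ _ _ h).append_left _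
      · intro i hi x hx y hy
        simp only [List.length_range] at hi
        obtain ⟨m, hm⟩ : ∃ m, n - 1 - i = m + 1 := ⟨n - 2 - i, by omega⟩
        have hm' : n - 1 - (i + 1) = m := by omega
        simp only [List.getElem_range, List.getLast?_map, List.head?_map, hm, hm',
          List.getLast?_reverse, List.head?_reverse, F_head k hk m] at hx hy
        cases hg : (F k m).getLast? with
        | none => simp [hg] at hx
        | some g =>
          simp [hg] at hx hy
          subst hx hy
          rw [List.replicate_succ', List.append_assoc]
          exact (DiffOne.head _ _ _ (by omega)).append_left _

theorem H_chain (q k n : ℕ) (hq : 2 ≤ q) (hk : 2 ≤ k) : (H q k n).IsChain DiffOne := by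
  have hbin : ∀ w ∈ F k (n - 2), ∀ x ∈ w ++ [1], x < 2 := by
    intro w hw x hx
    rcases List.mem_append.1 hx with hx | hx
    · exact F_bin k _ w hw x hx
    · simp at hx; omega
  have hbin1 : ∀ w ∈ F k (n - 2), ∀ x ∈ 1 :: (w ++ [1]), x < 2 := by
    intro w hw x hx
    rcases List.mem_cons.1 hx with hx | hx
    · omega
    · exact hbin w hw x hx
  have hF := F_chain k hk (n - 2)
  rw [List.isChain_iff_getElem] at hF
  rw [H]
  apply chain_flatMap
  · intro p _
    have : expand q (1 :: (p.1 ++ [1])) ≠ [] := by simpa [expand] using G_ne q hq _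
    split <;> simpa using this
  · intro p hp
    have hp' : p.1 ∈ F k (n - 2) := List.fst_mem_of_mem_zipIdx hp
    have := expand_chain q hq _ (hbin1 p.1 hp')
    split
    · exact this
    · exact chain_reverse this
  · intro i hi x hx y hy
    simp only [List.length_zipIdx] at hi
    simp only [List.getElem_zipIdx, Nat.zero_add] at hx hy
    have hd := (hF i hi).append_right [1]
    have b1 := hbin _ (List.getElem_mem (l := F k (n - 2)) (n := i) (by omega))
    have b2 := hbin _ (List.getElem_mem (l := F k (n - 2)) (n := i + 1) (by omega))
    rcases Nat.mod_two_eq_zero_or_one i with h | h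
    · have h' : (i + 1) % 2 = 1 := by omega
      simp only [h, h', if_true, Nat.one_ne_zero, if_false, List.head?_reverse,
        expand_last q hq _ b1, expand_last q hq _ b2, Option.mem_def, Option.some.injEq] at hx hy
      subst hx hy
      refine .tail _ _ _ (hd.map _ b1 b2 ?_)
      have hl : lastLetter q ≠ 0 := by
        unfold lastLetter
        split <;> omega
      simpa using hl.symm
    · have h' : (i + 1) % 2 = 0 := by omega
      simp only [h, h', if_true, Nat.one_ne_zero, if_false, List.getLast?_reverse,
        expand_head q hq _ b1, expand_head q hq _ b2, Option.mem_def, Option.some.injEq] at hx hy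
      subst hx hy
      exact .tail _ _ _ (hd.map _ b1 b2 (by simp))

/-- For every `q ≥ 2`, `k ≥ 2` and `n ≥ 2`, any two consecutive words of `H_{n,q}^{(k)}`
differ in exactly one position. -/
theorem stmt_14 (q k n : ℕ) (hq : 2 ≤ q) (hk : 2 ≤ k) (hn : 2 ≤ n) (i : ℕ) (a b : List ℕ)
    (ha : (H q k n)[i]? = some a) (hb : (H q k n)[i + 1]? = some b) :
    hamming a b = 1 := by
  have h := H_chain q k n hq hk
  rw [List.isChain_iff_getElem] at h
  obtain ⟨h1, rfl⟩ := List.getElem?_eq_some_iff.1 ha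
  obtain ⟨h2, rfl⟩ := List.getElem?_eq_some_iff.1 hb
  exact (h i h2).hamming
end

section
/- For every q ≥ 2, k ≥ 2 and n ≥ 2, the list H_{n,q}^{(k)} contains exactly once each word of length n over the alphabet {0,1,…,q−1} whose first and last letters are nonzero and which does not contain k consecutive 0's, and contains no other words. -/
theorem G_mem (q t : ℕ) : ∀ w, w ∈ G q t ↔ w.length = t ∧ ∀ x ∈ w, x ≠ 0 ∧ x < q := by
  induction t with
  | zero =>
    intro w
    simp only [G, List.mem_singleton, List.length_eq_zero_iff]
    constructor
    · rintro rfl; simp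
    · exact fun h => h.1
  | succ t ih =>
    intro w
    have hm : ∀ (j : ℕ) (u : List ℕ),
        u ∈ (if (j + 1) % 2 = 1 then G q t else (G q t).reverse) ↔ u ∈ G q t := by
      intro j u; split_ifs <;> simp
    simp only [G, List.mem_flatMap, List.mem_map, List.mem_range, hm, ih]
    constructor
    · rintro ⟨j, hj, u, ⟨hu, hx⟩, rfl⟩
      refine ⟨by simp [hu], ?_⟩
      intro x hx'
      rcases List.mem_cons.1 hx' with rfl | h
      · omega
      · exact hx x h
    · rintro ⟨hl, hx⟩
      cases w with
      | nil => simp at hl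
      | cons a u =>
        have ha := hx a (by simp)
        refine ⟨a - 1, by omega, u, ⟨by simpa using hl, fun x h => hx x (by simp [h])⟩, ?_⟩
        congr 1; omega

theorem G_nodup (q t : ℕ) : (G q t).Nodup := by
  induction t with
  | zero => simp [G]
  | succ t ih =>
    rw [G, List.nodup_flatMap]
    constructor
    · intro j _
      refine List.Nodup.map (fun a b h => by simpa using h) ?_
      split_ifs
      · exact ih
      · exact List.nodup_reverse.2 ih
    · refine List.nodup_range.imp ?_
      intro i j hij u h1 h2
      simp only [List.mem_map] at h1 h2
      obtain ⟨a, _, rfl⟩ := h1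
      obtain ⟨b, _, hb⟩ := h2
      simp at hb
      exact hij hb.1.symm

theorem trace_cons (a : ℕ) (w : List ℕ) :
    trace (a :: w) = (if a = 0 then 0 else 1) :: trace w := rfl

theorem subst_spec (q : ℕ) (β : List ℕ) (hb : ∀ x ∈ β, x = 0 ∨ x = 1) : ∀ v : List ℕ,
    v.length = β.count 1 → (∀ x ∈ v, x ≠ 0 ∧ x < q) →
    trace (subst β v) = β ∧ (0 < q → ∀ x ∈ subst β v, x < q) ∧
      (subst β v).filter (fun x => x ≠ 0) = v := by
  induction β with
  | nil =>
    intro v hv _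
    have : v = [] := by simpa using hv
    subst this
    simp [subst, trace]
  | cons a β ih =>
    intro v hv hx
    have ih := ih (fun x h => hb x (by simp [h]))
    rcases hb a (by simp) with rfl | rfl
    · obtain ⟨h1, h2, h3⟩ := ih v (by simpa using hv) hx
      refine ⟨by simp [subst, trace_cons, h1], ?_, ?_⟩
      · intro hq x h
        simp only [subst, List.mem_cons] at h
        rcases h with rfl | h
        · exact hq
        · exact h2 hq x h
      · simpa [subst] using h3
    · cases v with
      | nil => simp at hv
      | cons c v =>
        have hc := hx c (by simp)
        obtain ⟨h1, h2, h3⟩ := ih v (by simpa using hv) (fun x h => hx x (by simp [h]))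
        refine ⟨by simp [subst, trace_cons, h1, hc.1], ?_, ?_⟩
        · intro hq x h
          simp only [subst, List.mem_cons, List.headD_cons, List.tail_cons] at h
          rcases h with rfl | h
          · exact hc.2
          · exact h2 hq x h
        · simp only [subst, List.headD_cons, List.tail_cons]
          rw [List.filter_cons_of_pos (by simpa using hc.1), h3]

theorem subst_trace (w : List ℕ) : subst (trace w) (w.filter (fun x => x ≠ 0)) = w ∧
    (w.filter (fun x => x ≠ 0)).length = (trace w).count 1 := by
  induction w with
  | nil => simp [trace, subst]
  | cons a w ih =>
    rw [trace_cons]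
    by_cases ha : a = 0
    · subst ha
      simpa [subst] using ih
    · rw [List.filter_cons_of_pos (by simpa using ha)]
      simp only [ha, if_false, subst, List.headD_cons, List.tail_cons, ih.1, List.length_cons,
        ih.2, List.count_cons_self, and_self]

theorem expand_mem (q : ℕ) (hq : 0 < q) (β : List ℕ) (hb : ∀ x ∈ β, x = 0 ∨ x = 1)
    (w : List ℕ) : w ∈ expand q β ↔ trace w = β ∧ ∀ x ∈ w, x < q := by
  simp only [expand, List.mem_map, G_mem]
  constructor
  · rintro ⟨v, ⟨h1, h2⟩, rfl⟩
    have h := subst_spec q β hb v h1 h2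
    exact ⟨h.1, h.2.1 hq⟩
  · rintro ⟨rfl, h⟩
    refine ⟨w.filter (fun x => x ≠ 0), ⟨(subst_trace w).2, ?_⟩, (subst_trace w).1⟩
    intro x hx
    simp only [List.mem_filter, decide_eq_true_eq] at hx
    exact ⟨hx.2, h x hx.1⟩

theorem expand_nodup (q : ℕ) (β : List ℕ) (hb : ∀ x ∈ β, x = 0 ∨ x = 1) :
    (expand q β).Nodup := by
  refine List.Nodup.map_on ?_ (G_nodup _ _)
  intro u hu v hv h
  rw [G_mem] at hu hv
  rw [← (subst_spec q β hb u hu.1 hu.2).2.2, h, (subst_spec q β hb v hv.1 hv.2).2.2]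

theorem C_mem (n : ℕ) : ∀ w, w ∈ C n ↔ w.length = n ∧ ∀ x ∈ w, x = 0 ∨ x = 1 := by
  induction n with
  | zero =>
    intro w
    simp only [C, List.mem_singleton, List.length_eq_zero_iff]
    constructor
    · rintro rfl; simp
    · exact fun h => h.1
  | succ n ih =>
    intro w
    simp only [C, List.mem_append, List.mem_map, List.mem_reverse, ih]
    constructor
    · rintro (⟨u, ⟨h1, h2⟩, rfl⟩ | ⟨u, ⟨h1, h2⟩, rfl⟩) <;> simpa [h1] using h2
    · rintro ⟨hl, hx⟩
      cases w with
      | nil => simp at hl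
      | cons a u =>
        have hu : u.length = n ∧ ∀ x ∈ u, x = 0 ∨ x = 1 :=
          ⟨by simpa using hl, fun x h => hx x (by simp [h])⟩
        rcases hx a (by simp) with rfl | rfl
        · exact Or.inr ⟨u, hu, rfl⟩
        · exact Or.inl ⟨u, hu, rfl⟩

theorem C_nodup (n : ℕ) : (C n).Nodup := by
  induction n with
  | zero => simp [C]
  | succ n ih =>
    rw [C, List.nodup_append]
    refine ⟨List.Nodup.map (fun a b h => by simpa using h) (List.nodup_reverse.2 ih),
      List.Nodup.map (fun a b h => by simpa using h) ih, ?_⟩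
    intro a ha b hb
    simp only [List.mem_map] at ha hb
    obtain ⟨u, _, rfl⟩ := ha
    obtain ⟨v, _, rfl⟩ := hb
    simp

theorem not_prefix_run (k l a : ℕ) (w : List ℕ) (h : l < k) (ha : a ≠ 0) :
    ¬ List.replicate k 0 <+: List.replicate l 0 ++ a :: w := by
  induction l generalizing k with
  | zero =>
    obtain ⟨k, rfl⟩ : ∃ j, k = j + 1 := ⟨k - 1, by omega⟩
    simp only [List.replicate_succ, List.replicate_zero, List.nil_append, List.cons_prefix_cons]
    exact fun h => ha h.1.symm
  | succ l ih =>
    obtain ⟨k, rfl⟩ : ∃ j, k = j + 1 := ⟨k - 1, by omega⟩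
    simp only [List.replicate_succ, List.cons_append, List.cons_prefix_cons, true_and]
    exact ih k (by omega)

theorem infix_run (k l a : ℕ) (w : List ℕ) (h : l < k) (ha : a ≠ 0) :
    List.replicate k 0 <:+: List.replicate l 0 ++ a :: w ↔ List.replicate k 0 <:+: w := by
  induction l with
  | zero =>
    have := not_prefix_run k 0 a w h ha
    simp only [List.replicate_zero, List.nil_append] at this ⊢
    rw [List.infix_cons_iff]; tauto
  | succ l ih =>
    have := not_prefix_run k (l + 1) a w h ha
    simp only [List.replicate_succ, List.cons_append] at this ⊢
    rw [List.infix_cons_iff, ih (by omega)]; tauto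

theorem infix_ends (k a b : ℕ) (v : List ℕ) (hk : 0 < k) (ha : a ≠ 0) (hb : b ≠ 0) :
    List.replicate k 0 <:+: a :: (v ++ [b]) ↔ List.replicate k 0 <:+: v := by
  have h1 := infix_run k 0 a (v ++ [b]) hk ha
  simp only [List.replicate_zero, List.nil_append] at h1
  rw [h1, List.infix_concat_iff]
  constructor
  · rintro (h | h)
    · exfalso
      obtain ⟨s, hs⟩ := h
      obtain ⟨k, rfl⟩ : ∃ j, k = j + 1 := ⟨k - 1, by omega⟩
      rw [List.replicate_succ', ← List.append_assoc] at hs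
      have h2 := (List.append_inj' hs rfl).2
      simp only [List.cons.injEq, and_true] at h2
      exact hb h2.symm
    · exact h
  · exact Or.inr

theorem run_decomp (w : List ℕ) (hw : ∀ x ∈ w, x = 0 ∨ x = 1) :
    w = List.replicate w.length 0 ∨ ∃ l u, w = List.replicate l 0 ++ 1 :: u := by
  induction w with
  | nil => simp
  | cons a w ih =>
    rcases hw a (by simp) with rfl | rfl
    · rcases ih (fun x h => hw x (by simp [h])) with h | ⟨l, u, h⟩
      · left; rw [List.length_cons, List.replicate_succ, ← h]
      · right; exact ⟨l + 1, u, by rw [h, List.replicate_succ, List.cons_append]⟩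
    · right; exact ⟨0, w, rfl⟩

theorem F_mem (k : ℕ) (hk : 0 < k) (n : ℕ) : ∀ w, w ∈ F k n ↔
    w.length = n ∧ (∀ x ∈ w, x = 0 ∨ x = 1) ∧ ¬ List.replicate k 0 <:+: w := by
  induction n using Nat.strong_induction_on with
  | _ n ih =>
    intro w
    rw [F]
    split_ifs with hn
    · rw [C_mem]
      constructor
      · rintro ⟨h1, h2⟩
        refine ⟨h1, h2, fun h => ?_⟩
        have := h.length_le
        simp at this; omega
      · exact fun h => ⟨h.1, h.2.1⟩
    · simp only [List.mem_flatMap, List.mem_map, List.mem_reverse, List.mem_attach, true_and,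
        Subtype.exists, List.mem_range]
      constructor
      · rintro ⟨l, hl, u, hu, rfl⟩
        rw [ih _ (by omega)] at hu
        refine ⟨by simp [hu.1]; omega, ?_, ?_⟩
        · intro x hx
          simp only [List.mem_append, List.mem_replicate, List.mem_cons] at hx
          rcases hx with h | h | h
          · exact Or.inl h.2
          · exact Or.inr h
          · exact hu.2.1 x h
        · rw [infix_run k l 1 u hl one_ne_zero]; exact hu.2.2
      · rintro ⟨h1, h2, h3⟩
        rcases run_decomp w h2 with h | ⟨l, u, rfl⟩
        · exfalso; apply h3
          rw [h, h1]
          exact ⟨[], List.replicate (n - k) 0, by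
            rw [List.nil_append, List.replicate_append_replicate]; congr 1; omega⟩
        · have hl : l < k := by
            by_contra hl
            apply h3
            exact ⟨[], List.replicate (l - k) 0 ++ 1 :: u, by
              rw [List.nil_append, ← List.append_assoc, List.replicate_append_replicate]
              congr 2; omega⟩
          refine ⟨l, hl, u, ?_, rfl⟩
          rw [ih _ (by omega)]
          refine ⟨?_, fun x h => h2 x (by simp [h]), ?_⟩
          · simp at h1; omega
          · rwa [infix_run k l 1 u hl one_ne_zero] at h3

theorem run_inj (i j : ℕ) (u v : List ℕ)
    (h : List.replicate i 0 ++ 1 :: u = List.replicate j 0 ++ 1 :: v) : i = j ∧ u = v := by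
  induction i generalizing j with
  | zero => cases j <;> simp_all [List.replicate_succ]
  | succ i ih =>
    cases j with
    | zero => simp [List.replicate_succ] at h
    | succ j =>
      simp only [List.replicate_succ, List.cons_append, List.cons.injEq, true_and] at h
      have := ih j h
      exact ⟨by omega, this.2⟩

theorem F_nodup (k n : ℕ) : (F k n).Nodup := by
  induction n using Nat.strong_induction_on with
  | _ n ih =>
    rw [F]
    split_ifs with hn
    · exact C_nodup n
    · rw [List.nodup_flatMap]
      constructor
      · intro l _
        have := List.mem_range.1 l.2
        exact List.Nodup.map (fun a b h => (run_inj _ _ _ _ h).2)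
          (List.nodup_reverse.2 (ih _ (by omega)))
      · refine (List.nodup_attach.2 List.nodup_range).imp ?_
        intro i j hij u h1 h2
        simp only [List.mem_map] at h1 h2
        obtain ⟨a, _, rfl⟩ := h1
        obtain ⟨b, _, hb⟩ := h2
        exact hij (Subtype.ext (run_inj _ _ _ _ hb).1.symm)

theorem H_perm (q k n : ℕ) :
    (H q k n).Perm ((F k (n - 2)).flatMap fun φ => expand q (1 :: (φ ++ [1]))) := by
  have h : (F k (n - 2)).flatMap (fun φ => expand q (1 :: (φ ++ [1]))) =
      (F k (n - 2)).zipIdx.flatMap (fun p => expand q (1 :: (p.1 ++ [1]))) := by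
    conv_lhs => rw [← List.zipIdx_map_fst 0 (F k (n - 2))]
    rw [List.flatMap_map]
  rw [h, H]
  refine List.Perm.flatMap_left _ ?_
  intro p _
  split_ifs
  · exact List.Perm.refl _
  · exact List.reverse_perm _

theorem infix_trace (k : ℕ) (w : List ℕ) :
    List.replicate k 0 <:+: trace w ↔ List.replicate k 0 <:+: w := by
  constructor
  · rintro ⟨s, t, h⟩
    have h' := h.symm
    rw [trace, List.map_eq_append_iff] at h'
    obtain ⟨w1, w2, rfl, h1, _⟩ := h'
    rw [List.map_eq_append_iff] at h1
    obtain ⟨w3, w4, rfl, _, h4⟩ := h1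
    have : w4 = List.replicate k 0 := by
      rw [List.eq_replicate_iff]
      refine ⟨by simpa using congrArg List.length h4, ?_⟩
      intro b hb
      have : (if b = 0 then 0 else 1) ∈ List.replicate k 0 := by
        rw [← h4]; exact List.mem_map.2 ⟨b, hb, rfl⟩
      have := (List.mem_replicate.1 this).2
      by_contra hb0
      simp [hb0] at this
    exact ⟨w3, w2, by rw [this]⟩
  · intro h
    have := h.map (fun x => if x = 0 then 0 else 1)
    simpa [trace] using this

theorem H_mem (q k n : ℕ) (hq : 2 ≤ q) (hk : 2 ≤ k) (hn : 2 ≤ n) (w : List ℕ) :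
    w ∈ H q k n ↔ w.length = n ∧ (∀ x ∈ w, x < q) ∧ w.head? ≠ some 0 ∧ w.getLast? ≠ some 0 ∧
         ¬ (List.replicate k 0 <:+: w) := by
  rw [(H_perm q k n).mem_iff, List.mem_flatMap]
  have key : ∀ φ ∈ F k (n - 2), (w ∈ expand q (1 :: (φ ++ [1])) ↔
      trace w = 1 :: (φ ++ [1]) ∧ ∀ x ∈ w, x < q) := by
    intro φ hφ
    rw [F_mem k (by omega)] at hφ
    apply expand_mem q (by omega)
    intro x hx
    simp only [List.mem_cons, List.mem_append, List.not_mem_nil, or_false] at hx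
    rcases hx with h | h | h
    · exact Or.inr h
    · exact hφ.2.1 x h
    · exact Or.inr h
  have hlen : w.length = (trace w).length := by simp [trace]
  by_cases hw : 2 ≤ w.length
  swap
  · constructor
    · rintro ⟨φ, hφ, h⟩
      rw [key φ hφ] at h
      rw [hlen, h.1] at hw
      simp at hw
    · intro h; omega
  obtain ⟨a, v, b, rfl⟩ : ∃ a v b, w = a :: (v ++ [b]) := by
    cases w with
    | nil => simp at hw
    | cons a w =>
      rcases List.eq_nil_or_concat w with rfl | ⟨v, b, rfl⟩
      · simp at hw
      · exact ⟨a, v, b, by simp⟩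
  have htr : trace (a :: (v ++ [b])) =
      (if a = 0 then 0 else 1) :: (trace v ++ [if b = 0 then 0 else 1]) := by
    simp [trace]
  have hlast : (a :: (v ++ [b])).getLast? = some b := by
    rw [← List.cons_append, List.getLast?_concat]
  rw [hlast]
  simp only [List.head?_cons, ne_eq, Option.some.injEq]
  constructor
  · rintro ⟨φ, hφ, h⟩
    rw [key φ hφ, htr] at h
    rw [F_mem k (by omega)] at hφ
    obtain ⟨h1, h2⟩ := h
    rw [List.cons.injEq] at h1
    have h3 := List.append_inj' h1.2 rfl
    have ha : a ≠ 0 := by intro h; simp [h] at h1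
    have hb : b ≠ 0 := by intro h; simp [h] at h3
    obtain ⟨h3, -⟩ := h3
    subst h3
    refine ⟨?_, h2, ha, hb, ?_⟩
    · have := hφ.1
      simp [trace] at this ⊢; omega
    · rw [infix_ends k a b v (by omega) ha hb, ← infix_trace]; exact hφ.2.2
  · rintro ⟨h1, h2, ha, hb, h3⟩
    rw [infix_ends k a b v (by omega) ha hb, ← infix_trace] at h3
    have hφ : trace v ∈ F k (n - 2) := by
      rw [F_mem k (by omega)]
      refine ⟨?_, ?_, h3⟩
      · simp [trace] at h1 ⊢; omega
      · intro x hx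
        simp only [trace, List.mem_map] at hx
        obtain ⟨y, _, rfl⟩ := hx
        split_ifs <;> simp
    refine ⟨trace v, hφ, (key _ hφ).2 ⟨?_, h2⟩⟩
    rw [htr]; simp [ha, hb]

theorem H_nodup (q k n : ℕ) (hq : 2 ≤ q) (hk : 2 ≤ k) : (H q k n).Nodup := by
  rw [(H_perm q k n).nodup_iff, List.nodup_flatMap]
  have bin : ∀ φ ∈ F k (n - 2), ∀ x ∈ 1 :: (φ ++ [1]), x = 0 ∨ x = 1 := by
    intro φ hφ x hx
    rw [F_mem k (by omega)] at hφ
    simp only [List.mem_cons, List.mem_append, List.not_mem_nil, or_false] at hx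
    rcases hx with h | h | h
    · exact Or.inr h
    · exact hφ.2.1 x h
    · exact Or.inr h
  refine ⟨fun φ hφ => expand_nodup q _ (bin φ hφ), ?_⟩
  refine List.Pairwise.imp_of_mem ?_ (F_nodup k (n - 2))
  intro φ ψ hφ hψ hne u h1 h2
  rw [expand_mem q (by omega) _ (bin _ hφ)] at h1
  rw [expand_mem q (by omega) _ (bin _ hψ)] at h2
  apply hne
  have := h1.1.symm.trans h2.1
  simpa using this

/-- For every `q ≥ 2`, `k ≥ 2` and `n ≥ 2`, the list `H_{n,q}^{(k)}` contains exactly once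
each length-`n` word over `{0,…,q-1}` with nonzero first and last letters and no `k`
consecutive 0's, and contains no other words. -/
theorem stmt_15 (q k n : ℕ) (hq : 2 ≤ q) (hk : 2 ≤ k) (hn : 2 ≤ n) :
    ∀ w : List ℕ, (H q k n).count w =
      if w.length = n ∧ (∀ x ∈ w, x < q) ∧ w.head? ≠ some 0 ∧ w.getLast? ≠ some 0 ∧
         ¬ (List.replicate k 0 <:+: w)
      then 1 else 0 := by
  intro w
  have hm := H_mem q k n hq hk hn w
  split_ifs with h
  · exact List.count_eq_one_of_mem (H_nodup q k n hq hk) (hm.2 h)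
  · exact List.count_eq_zero_of_not_mem (fun h' => h (hm.1 h'))
end

section
/- For every k ≥ 2 and n ≥ 0, the list F_n^{(k)}(k−1) equals the list F_n^{(k)}; that is, the two recursive definitions produce the same list of binary words. -/
theorem Faux_eq_C (k : ℕ) : ∀ n u : ℕ, n ≤ u → u ≤ k - 1 → Faux k n u = C n := by
  intro n
  induction n with
  | zero => intro u _ _; simp [Faux, C]
  | succ n ih =>
    intro u h1 h2
    obtain ⟨v, rfl⟩ : ∃ v, u = v + 1 := ⟨u - 1, by omega⟩
    rw [Faux, C, ih (k - 1) (by omega) le_rfl, ih v (by omega) (by omega)]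

theorem Faux_unfold (k : ℕ) : ∀ u n : ℕ, u < n → Faux k n u =
    (List.range (u + 1)).flatMap (fun l =>
      ((Faux k (n - 1 - l) (k - 1)).reverse).map
        (fun w => List.replicate l 0 ++ 1 :: w)) := by
  intro u
  induction u with
  | zero =>
    intro n h
    obtain ⟨m, rfl⟩ : ∃ m, n = m + 1 := ⟨n - 1, by omega⟩
    simp [Faux]
  | succ u ih =>
    intro n h
    obtain ⟨m, rfl⟩ : ∃ m, n = m + 1 := ⟨n - 1, by omega⟩
    rw [Faux, ih m (by omega), List.range_succ_eq_map (n := u + 1), List.flatMap_cons,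
      List.flatMap_map, List.map_flatMap]
    congr 1
    congr 1
    funext l
    rw [List.map_map, show m + 1 - 1 - l.succ = m - 1 - l by omega]
    rfl

/-- For every `k ≥ 2` and `n ≥ 0`, the list `F_n^{(k)}(k-1)` equals the list `F_n^{(k)}`. -/
theorem stmt_17 (k n : ℕ) (hk : 2 ≤ k) :
    Faux k n (k - 1) = F k n := by
  induction n using Nat.strong_induction_on with
  | _ n ih =>
    rw [F]
    split_ifs with h
    · exact Faux_eq_C k n (k - 1) (by omega) le_rfl
    · rw [Faux_unfold k (k - 1) n (by omega), show k - 1 + 1 = k by omega]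
      conv_lhs => rw [← List.attach_map_subtype_val (List.range k)]
      rw [List.flatMap_map]
      congr 1
      funext l
      rw [ih (n - 1 - l.1) (by omega)]
end
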